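/- arXiv:1906.09713 — 10 statements merged into one kernel-verified Lean document; each statement's English description precedes it below -/
import Mathlib

section
/- As z → +∞, û(z) converges (in the extended reals) to E[V] + w; in particular lim sup_{z→+∞} û(z) ≤ E[V] + w. -/
open MeasureTheory Real Set Filter
open scoped ENNReal

/-- The subjective expected utility of an agent with immediate value `V`, future value `w`,
subjective present-bias factor `βh`, facing no-show penalty `z`:
`û(z) = E[(V + w)·1{V ≥ -z - β̂·w}] - z·P(V < -z - β̂·w)`. -/
noncomputable def uhat {Ω : Type*} [MeasurableSpace Ω] (P : Measure Ω)
    (V : Ω → ℝ) (w βh : ℝ) (z : ℝ) : ℝ :=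
  (∫ ω in {ω | V ω ≥ -z - βh * w}, (V ω + w) ∂P)
    - z * (P {ω | V ω < -z - βh * w}).toReal

/-- The loss of the penalised payoff against `max V 0 + w` at penalty `z`, where `t` is the
no-show threshold. -/
noncomputable def penaltyLoss (w t z v : ℝ) : ℝ :=
  if t ≤ v then max (-v) 0 else z + w

lemma measurable_penaltyLoss (w t z : ℝ) : Measurable (penaltyLoss w t z) :=
  Measurable.ite measurableSet_Ici (by fun_prop) measurable_const

lemma penaltyLoss_nonneg {w z : ℝ} (hw : 0 ≤ w) (hz : 0 ≤ z) (t v : ℝ) :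
    0 ≤ penaltyLoss w t z v := by
  unfold penaltyLoss
  split_ifs
  · exact le_max_right _ _
  · positivity

lemma integrable_penaltyLoss {Ω : Type*} [MeasurableSpace Ω] {P : Measure Ω}
    [IsProbabilityMeasure P] {V : Ω → ℝ} (hV : Measurable V) {w z : ℝ} (hw : 0 ≤ w) (hz : 0 ≤ z)
    (t : ℝ) : Integrable (fun ω => penaltyLoss w t z (V ω)) P := by
  refine Integrable.of_bound ((measurable_penaltyLoss w t z).comp hV).aestronglyMeasurable
    (|t| + (z + w)) (ae_of_all _ fun ω => ?_)
  rw [Real.norm_of_nonneg (penaltyLoss_nonneg hw hz _ _)]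
  unfold penaltyLoss
  split_ifs with h
  · have := neg_abs_le t
    exact max_le (by linarith) (by positivity)
  · linarith [abs_nonneg t]

lemma uhat_eq_sub_integral_penaltyLoss {Ω : Type*} [MeasurableSpace Ω] {P : Measure Ω}
    [IsProbabilityMeasure P] {V : Ω → ℝ} (hV : Measurable V) {w βh z : ℝ} (hw : 0 ≤ w)
    (hβ : 0 ≤ βh) (hz : 0 ≤ z) (hVint : Integrable (fun ω => max (V ω) 0) P) :
    uhat P V w βh z
      = ∫ ω, max (V ω) 0 ∂P - ∫ ω, penaltyLoss w (-z - βh * w) z (V ω) ∂P + w := by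
  have hg := integrable_penaltyLoss (P := P) hV hw hz (-z - βh * w)
  have hS : MeasurableSet {ω | V ω ≥ -z - βh * w} := measurableSet_le measurable_const hV
  have hcompl : {ω | V ω ≥ -z - βh * w}ᶜ = {ω | V ω < -z - βh * w} := by
    ext ω
    exact not_le (a := -z - βh * w) (b := V ω)
  have hsub : Integrable (fun ω => max (V ω) 0 - penaltyLoss w (-z - βh * w) z (V ω)) P :=
    hVint.sub hg
  have hfi : Integrable (fun ω => max (V ω) 0 - penaltyLoss w (-z - βh * w) z (V ω) + w) P :=
    hsub.add (integrable_const w)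
  have htot : ∫ ω, (max (V ω) 0 - penaltyLoss w (-z - βh * w) z (V ω) + w) ∂P
      = ∫ ω, max (V ω) 0 ∂P - ∫ ω, penaltyLoss w (-z - βh * w) z (V ω) ∂P + w := by
    rw [integral_add hsub (integrable_const w), integral_sub hVint hg]
    simp
  rw [← htot, ← integral_add_compl hS hfi, hcompl, uhat, sub_eq_add_neg]
  congr 1
  · refine setIntegral_congr_fun hS fun ω hω => ?_
    have hω' : -z - βh * w ≤ V ω := hω
    simp only [penaltyLoss, if_pos hω']
    rcases le_total 0 (V ω) with h | h
    · rw [max_eq_left h, max_eq_right (by linarith)]; ring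
    · rw [max_eq_right h, max_eq_left (by linarith)]; ring
  · rw [setIntegral_congr_fun (g := fun _ => -z) (hcompl ▸ hS.compl) fun ω hω => ?_]
    · simp [Measure.real, mul_comm]
    · have hω' : V ω < -z - βh * w := hω
      have : 0 ≤ βh * w := mul_nonneg hβ hw
      simp only [penaltyLoss, if_neg hω'.not_ge]
      rw [max_eq_right (by linarith)]; ring

lemma tendsto_lintegral_penaltyLoss {Ω : Type*} [MeasurableSpace Ω] {P : Measure Ω}
    [IsProbabilityMeasure P] {V : Ω → ℝ} (hV : Measurable V) {w c : ℝ}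
    (hc : 0 ≤ c) :
    Tendsto (fun z => ∫⁻ ω, ENNReal.ofReal (penaltyLoss w (-z - c) z (V ω)) ∂P) atTop
      (nhds (∫⁻ ω, ENNReal.ofReal (-V ω) ∂P)) := by
  have hev (ω : Ω) : ∀ᶠ z : ℝ in atTop, -z - c ≤ V ω := by
    filter_upwards [eventually_ge_atTop (-V ω - c)] with z hz
    linarith
  have hlow (z : ℝ) : ∫⁻ ω in {ω | -z - c ≤ V ω}, ENNReal.ofReal (-V ω) ∂P
      ≤ ∫⁻ ω, ENNReal.ofReal (penaltyLoss w (-z - c) z (V ω)) ∂P := by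
    rw [← lintegral_indicator (measurableSet_le measurable_const hV)]
    refine lintegral_mono fun ω => indicator_apply_le' (fun hω => ?_) (fun _ => zero_le)
    have hω' : -z - c ≤ V ω := hω
    rw [penaltyLoss, if_pos hω']
    exact ENNReal.ofReal_le_ofReal (le_max_left _ _)
  have hup (z : ℝ) : ∫⁻ ω, ENNReal.ofReal (penaltyLoss w (-z - c) z (V ω)) ∂P
      ≤ ∫⁻ ω, ENNReal.ofReal (-V ω) ∂P + ENNReal.ofReal w * P {ω | V ω < -z - c} := by
    have hS : MeasurableSet {ω | V ω < -z - c} := measurableSet_lt hV measurable_const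
    rw [← lintegral_indicator_const hS, ← lintegral_add_left (by fun_prop)]
    refine lintegral_mono fun ω => ?_
    by_cases h : -z - c ≤ V ω
    · rw [penaltyLoss, if_pos h, ENNReal.ofReal_max]
      simp
    · have h' : ω ∈ {ω | V ω < -z - c} := not_le.mp h
      have h'' := not_le.mp h
      rw [penaltyLoss, if_neg h, indicator_of_mem h']
      exact (ENNReal.ofReal_le_ofReal (by linarith)).trans ENNReal.ofReal_add_le
  have hmeas : Tendsto (fun z => P {ω | V ω < -z - c}) atTop (nhds 0) := by
    have hanti : Antitone fun z : ℝ => {ω | V ω < -z - c} := fun a b hab ω hω => by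
      have : V ω < -b - c := hω
      change V ω < -a - c
      linarith
    have hempty : ⋂ z : ℝ, {ω | V ω < -z - c} = ∅ := by
      refine eq_empty_of_forall_notMem fun ω hω => ?_
      obtain ⟨z, hz⟩ := (hev ω).exists
      exact absurd (mem_iInter.mp hω z) (not_lt.mpr hz)
    have := tendsto_measure_iInter_atTop (μ := P)
      (fun z : ℝ => (measurableSet_lt hV measurable_const).nullMeasurableSet) hanti
      ⟨0, measure_ne_top _ _⟩
    rwa [hempty, measure_empty] at this
  have hlim : Tendsto (fun z : ℝ => ∫⁻ ω in {ω | -z - c ≤ V ω}, ENNReal.ofReal (-V ω) ∂P) atTop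
      (nhds (∫⁻ ω, ENNReal.ofReal (-V ω) ∂P)) := by
    have hmono : Monotone fun z : ℝ => {ω | -z - c ≤ V ω} := fun a b hab ω hω => by
      have : -a - c ≤ V ω := hω
      change -b - c ≤ V ω
      linarith
    have huniv : ⋃ z : ℝ, {ω | -z - c ≤ V ω} = univ :=
      eq_univ_of_forall fun ω => mem_iUnion.mpr (hev ω).exists
    have := tendsto_measure_iUnion_atTop
      (μ := P.withDensity fun ω => ENNReal.ofReal (-V ω)) hmono
    rw [huniv, withDensity_apply _ MeasurableSet.univ, Measure.restrict_univ] at this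
    exact this.congr fun z => withDensity_apply _ (measurableSet_le measurable_const hV)
  refine tendsto_of_tendsto_of_tendsto_of_le_of_le hlim ?_ hlow hup
  simpa using tendsto_const_nhds.add
    (ENNReal.Tendsto.const_mul hmeas (Or.inr (ENNReal.ofReal_ne_top (r := w))))

/-- As `z → +∞`, `û(z)` converges in the extended reals to `E[V] + w`; in particular
`limsup_{z→+∞} û(z) ≤ E[V] + w`.  Here `E[V]`, a well-defined element of `[-∞, ∞)`
since `E[max(V,0)] < ∞`, is expressed as `E[max(V,0)] - ∫⁻ max(-V,0)` in `EReal`. -/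
theorem uhat_tendsto_atTop {Ω : Type*} [MeasurableSpace Ω] (P : Measure Ω)
    [IsProbabilityMeasure P] (V : Ω → ℝ) (hV : Measurable V)
    (w : ℝ) (hw : 0 ≤ w) (βh : ℝ) (hβh : βh ∈ Set.Icc (0 : ℝ) 1)
    (hA2 : Integrable (fun ω => max (V ω + w) 0) P) :
    Tendsto (fun z => ((uhat P V w βh z : ℝ) : EReal)) atTop
        (nhds ((((∫ ω, max (V ω) 0 ∂P : ℝ) : EReal)
            - ((∫⁻ ω, ENNReal.ofReal (-(V ω)) ∂P : ℝ≥0∞) : EReal)) + (w : ℝ)))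
      ∧ Filter.limsup (fun z => ((uhat P V w βh z : ℝ) : EReal)) atTop
          ≤ (((∫ ω, max (V ω) 0 ∂P : ℝ) : EReal)
              - ((∫⁻ ω, ENNReal.ofReal (-(V ω)) ∂P : ℝ≥0∞) : EReal)) + (w : ℝ) := by
  have hVint : Integrable (fun ω => max (V ω) 0) P := by
    refine hA2.mono' (by fun_prop) (ae_of_all _ fun ω => ?_)
    rw [Real.norm_of_nonneg (le_max_right _ _)]
    exact max_le_max (by linarith) le_rfl
  have hlim := tendsto_lintegral_penaltyLoss (P := P) hV (w := w) (mul_nonneg hβh.1 hw)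
  have hcont : Continuous fun x : ℝ≥0∞ =>
      ((∫ ω, max (V ω) 0 ∂P : ℝ) : EReal) - (x : EReal) + (w : ℝ) := by
    have hadd (r : ℝ) : Continuous fun y : EReal => (r : EReal) + y :=
      continuous_iff_continuousAt.mpr fun y =>
        EReal.continuousAt_add (by simp) (by simp)
          |>.comp (f := fun y : EReal => ((r : EReal), y)) (by fun_prop)
    simp_rw [add_comm _ (w : EReal), sub_eq_add_neg]
    exact (hadd w).comp ((hadd _).comp (continuous_neg.comp continuous_coe_ennreal_ereal))
  have htend : Tendsto (fun z => ((uhat P V w βh z : ℝ) : EReal)) atTop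
      (nhds ((((∫ ω, max (V ω) 0 ∂P : ℝ) : EReal)
        - ((∫⁻ ω, ENNReal.ofReal (-(V ω)) ∂P : ℝ≥0∞) : EReal)) + (w : ℝ))) := by
    refine ((hcont.tendsto _).comp hlim).congr' ?_
    filter_upwards [eventually_ge_atTop 0] with z hz
    have hg0 : 0 ≤ ∫ ω, penaltyLoss w (-z - βh * w) z (V ω) ∂P :=
      integral_nonneg fun ω => penaltyLoss_nonneg hw hz _ _
    rw [uhat_eq_sub_integral_penaltyLoss hV hw hβh.1 hz hVint, Function.comp_apply,
      ← ofReal_integral_eq_lintegral_ofReal (integrable_penaltyLoss hV hw hz _)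
        (ae_of_all _ fun ω => penaltyLoss_nonneg hw hz _ _),
      EReal.coe_ennreal_ofReal, max_eq_left hg0]
    norm_cast
  exact ⟨htend, htend.limsup_eq.le⟩
end

section
/- The function û : ℝ → ℝ is right-continuous: for every z* ∈ ℝ, û(z) → û(z*) as z ↓ z*. -/
open MeasureTheory Real Set Filter
open scoped ENNReal

/-- As `z ↓ a`, the truth value of `v < -z - c` is eventually that of `v < -a - c`. -/
lemma eventually_lt_sub_iff (v c a : ℝ) :
    ∀ᶠ z in nhdsWithin a (Set.Ioi a), (v < -z - c ↔ v < -a - c) := by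
  rcases lt_or_ge v (-a - c) with h | h
  · have hz : ∀ᶠ z in nhdsWithin a (Set.Ioi a), z < -c - v :=
      nhdsWithin_le_nhds (Iio_mem_nhds (by linarith))
    filter_upwards [hz] with z hz
    exact iff_of_true (by linarith) h
  · filter_upwards [self_mem_nhdsWithin] with z hz
    have hz : a < z := hz
    exact iff_of_false (by linarith) (by linarith)

/-- The expected total value collected on the show-up event is right-continuous in the penalty. -/
lemma tendsto_integral_ge_sub {Ω : Type*} [MeasurableSpace Ω] (P : Measure Ω)
    [IsFiniteMeasure P] {V : Ω → ℝ} (hV : Measurable V) (w c : ℝ)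
    (hint : Integrable (fun ω => max (V ω + w) 0) P) (a : ℝ) :
    Tendsto (fun z => ∫ ω in {ω | V ω ≥ -z - c}, (V ω + w) ∂P) (nhdsWithin a (Set.Ioi a))
      (nhds (∫ ω in {ω | V ω ≥ -a - c}, (V ω + w) ∂P)) := by
  have hmeas (z : ℝ) : MeasurableSet {ω | V ω ≥ -z - c} := measurableSet_le measurable_const hV
  simp_rw [← integral_indicator (hmeas _)]
  refine tendsto_integral_filter_of_dominated_convergence
    (fun ω => max (V ω + w) 0 + |a + 1 + c - w|) ?_ ?_ (hint.add (integrable_const _)) ?_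
  · exact .of_forall fun z => ((hV.add_const w).indicator (hmeas z)).aestronglyMeasurable
  · have hz : ∀ᶠ z in nhdsWithin a (Set.Ioi a), z < a + 1 :=
      nhdsWithin_le_nhds (Iio_mem_nhds (by linarith))
    filter_upwards [hz] with z hz
    refine .of_forall fun ω => ?_
    have h0 := le_max_right (V ω + w) 0
    have h1 := le_max_left (V ω + w) 0
    have h2 := le_abs_self (a + 1 + c - w)
    have h3 := abs_nonneg (a + 1 + c - w)
    by_cases h : V ω ≥ -z - c
    · rw [Set.indicator_of_mem (by exact h), Real.norm_eq_abs, abs_le]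
      constructor <;> linarith
    · rw [Set.indicator_of_notMem (by exact h), norm_zero]
      positivity
  · refine .of_forall fun ω => tendsto_nhds_of_eventually_eq ?_
    filter_upwards [eventually_lt_sub_iff (V ω) c a] with z hz
    simp only [Set.indicator, Set.mem_ofPred_eq, ge_iff_le, ← not_lt, hz]

/-- The no-show probability is right-continuous in the penalty. -/
lemma tendsto_measure_lt_sub {Ω : Type*} [MeasurableSpace Ω] (P : Measure Ω)
    [IsFiniteMeasure P] {V : Ω → ℝ} (hV : Measurable V) (c a : ℝ) :
    Tendsto (fun z => (P {ω | V ω < -z - c}).toReal) (nhdsWithin a (Set.Ioi a))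
      (nhds (P {ω | V ω < -a - c}).toReal) := by
  have hmeas (z : ℝ) : MeasurableSet {ω | V ω < -z - c} := measurableSet_lt hV measurable_const
  refine (ENNReal.tendsto_toReal (measure_ne_top P _)).comp ?_
  exact tendsto_measure_of_tendsto_indicator_of_isFiniteMeasure _ P hmeas
    (fun ω => eventually_lt_sub_iff (V ω) c a)

/-- `û` is right-continuous: for every `z*`, `û(z) → û(z*)` as `z ↓ z*`. -/
theorem uhat_right_continuous {Ω : Type*} [MeasurableSpace Ω] (P : Measure Ω)
    [IsProbabilityMeasure P] (V : Ω → ℝ) (hV : Measurable V)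
    (w : ℝ) (hw : 0 ≤ w) (βh : ℝ) (hβh : βh ∈ Set.Icc (0 : ℝ) 1)
    (hA2 : Integrable (fun ω => max (V ω + w) 0) P) :
    ∀ zs : ℝ, Tendsto (fun z => uhat P V w βh z) (nhdsWithin zs (Set.Ioi zs))
      (nhds (uhat P V w βh zs)) := by
  intro zs
  exact (tendsto_integral_ge_sub P hV w (βh * w) hA2 zs).sub
    ((tendsto_id.mono_left nhdsWithin_le_nhds).mul (tendsto_measure_lt_sub P hV (βh * w) zs))
end

section
/- The function Û(z) = sup_{z' ≥ z} û(z') is real-valued, monotonically non-increasing, and continuous on ℝ. -/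
open MeasureTheory Real Set Filter
open scoped ENNReal

theorem antitone_sSup_image_Ici {f : ℝ → ℝ} (hb : ∀ z, BddAbove (f '' Ici z)) :
    Antitone (fun z => sSup (f '' Ici z)) := fun a _ hab =>
  csSup_le_csSup (hb a) (nonempty_Ici.image f) (image_mono (Ici_subset_Ici.2 hab))

/-- If `f z + z` is monotone, then the running supremum of `f` from the right is
`1`-Lipschitz. -/
theorem lipschitzWith_sSup_image_Ici {f : ℝ → ℝ} (hb : ∀ z, BddAbove (f '' Ici z))
    (hf : Monotone (fun z => f z + z)) :
    LipschitzWith 1 (fun z => sSup (f '' Ici z)) := by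
  refine LipschitzWith.of_le_add fun x y => csSup_le (nonempty_Ici.image f) ?_
  rintro _ ⟨t, ht : x ≤ t, rfl⟩
  have hdist : y - x ≤ dist x y := by
    rw [dist_comm, Real.dist_eq]
    exact le_abs_self _
  rcases le_total y t with hyt | hty
  · have := le_csSup (hb y) (mem_image_of_mem f hyt)
    linarith [dist_nonneg (x := x) (y := y)]
  · have h₁ : f t + t ≤ f y + y := hf hty
    have h₂ := le_csSup (hb y) (mem_image_of_mem f self_mem_Ici)
    linarith

section Uhat

variable {Ω : Type*} [MeasurableSpace Ω] {P : Measure Ω} {V : Ω → ℝ} {w βh : ℝ}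

theorem measurableSet_attend (hV : Measurable V) (z : ℝ) :
    MeasurableSet {ω | V ω ≥ -z - βh * w} :=
  measurableSet_le measurable_const hV

theorem integrableOn_attend [IsFiniteMeasure P] (hV : Measurable V)
    (hA2 : Integrable (fun ω => max (V ω + w) 0) P) (z : ℝ) :
    IntegrableOn (fun ω => V ω + w) {ω | V ω ≥ -z - βh * w} P := by
  refine Integrable.mono' (hA2.add (integrable_const |-z - βh * w + w|)).integrableOn
    (hV.add_const w).aestronglyMeasurable ?_
  refine (ae_restrict_mem (measurableSet_attend hV z)).mono fun ω (hω : _ ≤ V ω) => ?_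
  simp only [Pi.add_apply, Real.norm_eq_abs]
  refine abs_le.2 ⟨?_, ?_⟩
  · linarith [neg_abs_le (-z - βh * w + w), le_max_right (V ω + w) 0]
  · linarith [abs_nonneg (-z - βh * w + w), le_max_left (V ω + w) 0]

theorem uhat_add_self_eq_setIntegral [IsProbabilityMeasure P] (hV : Measurable V)
    (hA2 : Integrable (fun ω => max (V ω + w) 0) P) (z : ℝ) :
    uhat P V w βh z + z = ∫ ω in {ω | V ω ≥ -z - βh * w}, (V ω + w + z) ∂P := by
  have hcompl : {ω | V ω < -z - βh * w} = {ω | V ω ≥ -z - βh * w}ᶜ := by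
    ext ω
    exact (not_le (a := -z - βh * w) (b := V ω)).symm
  have hP : (P {ω | V ω < -z - βh * w}).toReal = 1 - P.real {ω | V ω ≥ -z - βh * w} := by
    rw [hcompl]
    exact probReal_compl_eq_one_sub (measurableSet_attend hV z)
  rw [integral_add (integrableOn_attend hV hA2 z) (integrable_const z), setIntegral_const,
    uhat, hP, smul_eq_mul]
  ring

theorem monotone_uhat_add_self [IsProbabilityMeasure P] (hV : Measurable V) (hw : 0 ≤ w)
    (hβ : βh ≤ 1) (hA2 : Integrable (fun ω => max (V ω + w) 0) P) :
    Monotone (fun z => uhat P V w βh z + z) := by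
  intro a b hab
  have hβw : βh * w ≤ w := mul_le_of_le_one_left hw hβ
  have hint : ∀ c z, IntegrableOn (fun ω => V ω + w + c) {ω | V ω ≥ -z - βh * w} P :=
    fun c z => (integrableOn_attend hV hA2 z).add (integrable_const c)
  have hsub : {ω | V ω ≥ -a - βh * w} ⊆ {ω | V ω ≥ -b - βh * w} :=
    fun ω (hω : _ ≤ V ω) => show _ ≤ V ω by linarith
  simp only [uhat_add_self_eq_setIntegral hV hA2]
  calc ∫ ω in {ω | V ω ≥ -a - βh * w}, (V ω + w + a) ∂P
      ≤ ∫ ω in {ω | V ω ≥ -a - βh * w}, (V ω + w + b) ∂P :=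
        setIntegral_mono (hint a a) (hint b a) fun ω => by
          simpa using hab
    _ ≤ ∫ ω in {ω | V ω ≥ -b - βh * w}, (V ω + w + b) ∂P := by
        refine setIntegral_mono_set (hint b b) ?_ hsub.eventuallyLE
        refine (ae_restrict_mem (measurableSet_attend hV b)).mono fun ω (hω : _ ≤ V ω) => ?_
        simp only [Pi.zero_apply]
        linarith

theorem uhat_le [IsProbabilityMeasure P] (hV : Measurable V)
    (hA2 : Integrable (fun ω => max (V ω + w) 0) P) (z : ℝ) :
    uhat P V w βh z ≤ (∫ ω, max (V ω + w) 0 ∂P) + max (-z) 0 := by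
  have h₁ : ∫ ω in {ω | V ω ≥ -z - βh * w}, (V ω + w) ∂P ≤ ∫ ω, max (V ω + w) 0 ∂P :=
    (setIntegral_mono (integrableOn_attend hV hA2 z) hA2.integrableOn
      fun ω => le_max_left _ _).trans
      (setIntegral_le_integral hA2 (ae_of_all _ fun ω => le_max_right _ _))
  have h₂ : -z * P.real {ω | V ω < -z - βh * w} ≤ max (-z) 0 :=
    (mul_le_mul_of_nonneg_right (le_max_left (-z) 0) measureReal_nonneg).trans
      (mul_le_of_le_one_right (le_max_right _ _) measureReal_le_one)
  rw [Measure.real] at h₂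
  rw [uhat]
  linarith

theorem bddAbove_uhat_image_Ici [IsProbabilityMeasure P] (hV : Measurable V)
    (hA2 : Integrable (fun ω => max (V ω + w) 0) P) (z : ℝ) :
    BddAbove (uhat P V w βh '' Ici z) := by
  refine ⟨(∫ ω, max (V ω + w) 0 ∂P) + max (-z) 0, ?_⟩
  rintro _ ⟨t, ht : z ≤ t, rfl⟩
  refine (uhat_le hV hA2 t).trans ?_
  gcongr

end Uhat

/-- `Û(z) = sup_{z' ≥ z} û(z')` is real-valued (the supremum is over a set of reals bounded
above), monotonically non-increasing, and continuous. -/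
theorem Uhat_bdd_antitone_continuous {Ω : Type*} [MeasurableSpace Ω] (P : Measure Ω)
    [IsProbabilityMeasure P] (V : Ω → ℝ) (hV : Measurable V)
    (w : ℝ) (hw : 0 ≤ w) (βh : ℝ) (hβh : βh ∈ Set.Icc (0 : ℝ) 1)
    (hA2 : Integrable (fun ω => max (V ω + w) 0) P) :
    (∀ z : ℝ, BddAbove (uhat P V w βh '' Set.Ici z))
      ∧ Antitone (fun z => sSup (uhat P V w βh '' Set.Ici z))
      ∧ Continuous (fun z => sSup (uhat P V w βh '' Set.Ici z)) := by
  have hb : ∀ z, BddAbove (uhat P V w βh '' Ici z) := bddAbove_uhat_image_Ici hV hA2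
  exact ⟨hb, antitone_sSup_image_Ici hb,
    (lipschitzWith_sSup_image_Ici hb (monotone_uhat_add_self hV hw hβh.2 hA2)).continuous⟩
end

section
/- There exists a zero-crossing z⁰ ∈ ℝ such that Û(z⁰) = 0 and Û(z) < 0 for all z > z⁰; moreover z⁰ ≥ 0. -/
open MeasureTheory Real Set Filter
open scoped ENNReal

open Topology in
/-- A right-continuous function whose jumps are all upward is upper semicontinuous. -/
theorem upperSemicontinuous_of_monotone_add_id {f : ℝ → ℝ}
    (hmono : Monotone fun z => f z + z) (hright : ∀ x, ContinuousWithinAt f (Ici x) x) :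
    UpperSemicontinuous f := by
  intro x y hxy
  have hr : ∀ᶠ z in 𝓝[≥] x, f z < y := (hright x).eventually_lt_const hxy
  have hc : ContinuousAt (fun z => f x + x - z) x := by fun_prop
  have hl : ∀ᶠ z in 𝓝[≤] x, f z < y := by
    have h1 : ∀ᶠ z in 𝓝[≤] x, f x + x - z < y :=
      (hc.eventually_lt_const (by simpa using hxy)).filter_mono nhdsWithin_le_nhds
    filter_upwards [h1, self_mem_nhdsWithin] with z hz hzx
    have : f z + z ≤ f x + x := hmono hzx
    linarith
  rw [← nhdsLE_sup_nhdsGE x]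
  exact Filter.eventually_sup.mpr ⟨hl, hr⟩

open Topology in
/-- A right-continuous function with only upward jumps, nonnegative at `0` and eventually bounded
away from `0` by a negative constant, has a last zero, beyond which its tail suprema are
negative. -/
theorem exists_last_zero {f : ℝ → ℝ} (hmono : Monotone fun z => f z + z)
    (hright : ∀ x, ContinuousWithinAt f (Ici x) x) (h0 : 0 ≤ f 0)
    {M C : ℝ} (hC : C < 0) (htail : ∀ z ≥ M, f z ≤ C) :
    ∃ z0 : ℝ, 0 ≤ z0 ∧ sSup (f '' Ici z0) = 0 ∧ ∀ z > z0, sSup (f '' Ici z) < 0 := by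
  have husc := upperSemicontinuous_of_monotone_add_id hmono hright
  have hclosed : IsClosed {z | 0 ≤ f z} := husc.isClosed_preimage 0
  have hbdd : BddAbove {z | 0 ≤ f z} := by
    refine ⟨M, fun z hz => ?_⟩
    by_contra! h
    have := htail z h.le
    have : 0 ≤ f z := hz
    linarith
  set z0 := sSup {z | 0 ≤ f z}
  have hz0 : 0 ≤ f z0 := hclosed.csSup_mem ⟨0, h0⟩ hbdd
  have hneg : ∀ z > z0, f z < 0 := fun z hz => by
    by_contra! h
    exact absurd (le_csSup hbdd h) (not_le.mpr hz)
  have hz0' : f z0 ≤ 0 := by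
    have ht : Tendsto f (𝓝[>] z0) (𝓝 (f z0)) :=
      (hright z0).mono_left (nhdsWithin_mono _ Ioi_subset_Ici_self)
    refine le_of_tendsto ht ?_
    filter_upwards [self_mem_nhdsWithin] with z hz
    exact (hneg z hz).le
  have heq : f z0 = 0 := le_antisymm hz0' hz0
  refine ⟨z0, le_csSup hbdd h0, ?_, fun z hz => ?_⟩
  · refine IsGreatest.csSup_eq ⟨⟨z0, self_mem_Ici, heq⟩, ?_⟩
    rintro _ ⟨z, hz, rfl⟩
    rcases eq_or_lt_of_le (mem_Ici.mp hz) with rfl | h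
    · exact hz0'
    · exact (hneg z h).le
  · obtain ⟨x, hx, hmax⟩ := (husc.upperSemicontinuousOn (Icc z (max z M))).exists_isMaxOn
      (nonempty_Icc.mpr (le_max_left _ _)) isCompact_Icc
    have hfx : f x < 0 := hneg x (lt_of_lt_of_le hz hx.1)
    refine lt_of_le_of_lt (csSup_le (nonempty_Ici.image f) ?_) (max_lt hfx hC)
    rintro _ ⟨y, hy, rfl⟩
    rcases le_total y M with h | h
    · exact le_max_of_le_left (hmax ⟨hy, h.trans (le_max_right _ _)⟩)
    · exact le_max_of_le_right (htail y h)

section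

variable {Ω : Type*} [MeasurableSpace Ω] {P : Measure Ω} [IsProbabilityMeasure P] {V : Ω → ℝ}

/-- Truncation from below preserves integrability of the positive part. -/
theorem integrable_max_of_integrable_pos_part (hV : Measurable V) {a b : ℝ} (hab : b ≤ a)
    (hA : Integrable (fun ω => max (V ω + a) 0) P) (z : ℝ) :
    Integrable (fun ω => max (V ω + b) z) P := by
  refine (hA.add (integrable_const |z|)).mono' (by fun_prop) (ae_of_all _ fun ω => ?_)
  simp only [Pi.add_apply, Real.norm_eq_abs]
  have h1 := le_max_left (V ω + a) 0
  have h2 := le_max_right (V ω + a) 0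
  refine abs_le.mpr ⟨?_, max_le ?_ ?_⟩
  · linarith [neg_abs_le z, le_max_right (V ω + b) z]
  · linarith [abs_nonneg z]
  · linarith [le_abs_self z]

/-- `û` splits into a continuous part and a multiple of the distribution function of
`-V - β̂ w`. -/
theorem uhat_eq_integral_max_add_cdf (hV : Measurable V) {w βh : ℝ} (hb : βh * w ≤ w)
    (hA2 : Integrable (fun ω => max (V ω + w) 0) P) (z : ℝ) :
    uhat P V w βh z = ∫ ω, max (V ω + βh * w) (-z) ∂P
      + (w - βh * w) * ProbabilityTheory.cdf (P.map fun ω => -V ω - βh * w) z := by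
  have hX : Measurable fun ω => -V ω - βh * w := by fun_prop
  have : IsProbabilityMeasure (P.map fun ω => -V ω - βh * w) :=
    Measure.isProbabilityMeasure_map hX.aemeasurable
  have hint := integrable_max_of_integrable_pos_part hV hb hA2 (-z)
  set S := {ω | V ω ≥ -z - βh * w} with hS
  have hSm : MeasurableSet S := measurableSet_le measurable_const hV
  have hcompl : {ω | V ω < -z - βh * w} = Sᶜ := by
    ext ω
    simp only [hS, mem_compl_iff, mem_ofPred_eq, ge_iff_le, not_le]
  have hcdf : ProbabilityTheory.cdf (P.map fun ω => -V ω - βh * w) z = P.real S := by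
    rw [ProbabilityTheory.cdf_eq_real, map_measureReal_apply hX measurableSet_Iic]
    congr 1
    ext ω
    simp only [mem_preimage, mem_Iic, hS, mem_ofPred_eq]
    constructor <;> intro h <;> linarith
  have h1 : ∫ ω in S, (V ω + w) ∂P
      = ∫ ω in S, max (V ω + βh * w) (-z) ∂P + (w - βh * w) * P.real S := by
    have : ∫ ω in S, (V ω + w) ∂P
        = ∫ ω in S, (max (V ω + βh * w) (-z) + (w - βh * w)) ∂P := by
      refine setIntegral_congr_fun hSm fun ω hω => ?_
      have hω' : V ω ≥ -z - βh * w := hω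
      rw [max_eq_left (by linarith)]
      ring
    rw [this, integral_add hint.integrableOn (integrable_const _), setIntegral_const, smul_eq_mul,
      mul_comm (P.real S)]
  have h2 : ∫ ω in Sᶜ, max (V ω + βh * w) (-z) ∂P = -z * P.real Sᶜ := by
    have : ∫ ω in Sᶜ, max (V ω + βh * w) (-z) ∂P = ∫ ω in Sᶜ, -z ∂P := by
      refine setIntegral_congr_fun hSm.compl fun ω hω => ?_
      have hω' : V ω < -z - βh * w := not_le.mp hω
      exact max_eq_right (by linarith)
    rw [this, setIntegral_const, smul_eq_mul, mul_comm]
  rw [uhat, hcompl, ← hS, h1, hcdf, ← integral_add_compl hSm hint, h2, Measure.real, Measure.real]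
  ring

/-- If the extended expectation of `V` plus `w` is negative, then so is the expectation of `V`
truncated at a low enough level, plus `w`. -/
theorem exists_integral_max_neg_add_neg (hV : Measurable V) {w : ℝ} (hw : 0 ≤ w)
    (hpos : Integrable (fun ω => max (V ω) 0) P)
    (hneg : (((∫ ω, max (V ω) 0 ∂P : ℝ) : EReal)
        - ((∫⁻ ω, ENNReal.ofReal (-(V ω)) ∂P : ℝ≥0∞) : EReal)) + (w : ℝ) < 0) :
    ∃ n : ℕ, ∫ ω, max (V ω) (-n) ∂P + w < 0 := by
  set a := ∫ ω, max (V ω) 0 ∂P with ha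
  have ha0 : 0 ≤ a := integral_nonneg fun ω => le_max_right _ _
  have hlt : ENNReal.ofReal (a + w) < ∫⁻ ω, ENNReal.ofReal (-(V ω)) ∂P := by
    generalize ∫⁻ ω, ENNReal.ofReal (-(V ω)) ∂P = L at hneg
    induction L with
    | top => exact ENNReal.ofReal_lt_top
    | coe l =>
      have h : a - (l : ℝ) + w < 0 := by
        have : ((a - (l : ℝ) + w : ℝ) : EReal) < ((0 : ℝ) : EReal) := by
          push_cast
          exact hneg
        exact EReal.coe_lt_coe_iff.mp this
      rw [← ENNReal.ofReal_coe_nnreal]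
      exact (ENNReal.ofReal_lt_ofReal_iff (by linarith)).mpr (by linarith)
  have hsup : ∫⁻ ω, ENNReal.ofReal (-(V ω)) ∂P
      = ⨆ n : ℕ, ∫⁻ ω, ENNReal.ofReal (min (-(V ω)) n) ∂P := by
    rw [← lintegral_iSup (fun n => by fun_prop)]
    · refine lintegral_congr fun ω => le_antisymm ?_ ?_
      · obtain ⟨n, hn⟩ := exists_nat_ge (-(V ω))
        exact le_iSup_of_le n (by rw [min_eq_left hn])
      · exact iSup_le fun n => ENNReal.ofReal_le_ofReal (min_le_left _ _)
    · intro m n hmn ω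
      exact ENNReal.ofReal_le_ofReal (min_le_min le_rfl (by exact_mod_cast hmn))
  rw [hsup, lt_iSup_iff] at hlt
  obtain ⟨n, hn⟩ := hlt
  have hn0 : (0 : ℝ) ≤ n := n.cast_nonneg
  have hint : Integrable (fun ω => max (min (-(V ω)) n) 0) P := by
    refine (integrable_const (n : ℝ)).mono' (by fun_prop) (ae_of_all _ fun ω => ?_)
    rw [Real.norm_eq_abs, abs_of_nonneg (le_max_right _ _)]
    exact max_le (min_le_right _ _) hn0
  have hreal : ∫⁻ ω, ENNReal.ofReal (min (-(V ω)) n) ∂P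
      = ENNReal.ofReal (∫ ω, max (min (-(V ω)) n) 0 ∂P) := by
    rw [ofReal_integral_eq_lintegral_ofReal hint (ae_of_all _ fun ω => le_max_right _ _)]
    refine lintegral_congr fun ω => ?_
    simp [ENNReal.ofReal_max]
  rw [hreal, ENNReal.ofReal_lt_ofReal_iff_of_nonneg (by linarith)] at hn
  refine ⟨n, ?_⟩
  have hsplit : ∫ ω, max (V ω) (-n) ∂P = a - ∫ ω, max (min (-(V ω)) n) 0 ∂P := by
    rw [ha, ← integral_sub hpos hint]
    refine integral_congr_ae (ae_of_all _ fun ω => ?_)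
    simp only
    rcases le_total 0 (V ω) with h | h
    · rw [max_eq_left h, max_eq_left (by linarith),
        max_eq_right ((min_le_left _ _).trans (by linarith)), sub_zero]
    · rw [max_eq_right h, max_eq_left (le_min (by linarith) hn0), zero_sub, ← max_neg_neg, neg_neg]
  linarith

end

/-- Under (A2) and (A3), the function `Û(z) = sup_{z' ≥ z} û(z')` has a zero-crossing
`z⁰ ≥ 0`: `Û(z⁰) = 0` and `Û(z) < 0` for all `z > z⁰`.  (A3) says `E[V] + w < 0`, where
`E[V]`, well defined in `[-∞, ∞)`, is expressed in `EReal`. -/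
theorem Uhat_exists_zero_crossing {Ω : Type*} [MeasurableSpace Ω] (P : Measure Ω)
    [IsProbabilityMeasure P] (V : Ω → ℝ) (hV : Measurable V)
    (w : ℝ) (hw : 0 ≤ w) (βh : ℝ) (hβh : βh ∈ Set.Icc (0 : ℝ) 1)
    (hA2 : Integrable (fun ω => max (V ω + w) 0) P)
    (hA3 : (((∫ ω, max (V ω) 0 ∂P : ℝ) : EReal)
        - ((∫⁻ ω, ENNReal.ofReal (-(V ω)) ∂P : ℝ≥0∞) : EReal)) + (w : ℝ) < 0) :
    ∃ z0 : ℝ, 0 ≤ z0 ∧ sSup (uhat P V w βh '' Set.Ici z0) = 0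
      ∧ ∀ z > z0, sSup (uhat P V w βh '' Set.Ici z) < 0 := by
  obtain ⟨hβ0, hβ1⟩ := hβh
  have hb : βh * w ≤ w := by nlinarith
  have hueq := uhat_eq_integral_max_add_cdf (P := P) hV hb hA2
  have hint := integrable_max_of_integrable_pos_part (P := P) hV hb hA2
  set A : ℝ → ℝ := fun z => ∫ ω, max (V ω + βh * w) (-z) ∂P with hAdef
  set F := ProbabilityTheory.cdf (P.map fun ω => -V ω - βh * w)
  have : IsProbabilityMeasure (P.map fun ω => -V ω - βh * w) :=
    Measure.isProbabilityMeasure_map (by fun_prop)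
  have hA_anti : Antitone A := fun x y hxy =>
    integral_mono (hint _) (hint _) fun ω => max_le_max le_rfl (neg_le_neg hxy)
  have hA_add : Monotone fun z => A z + z := fun x y hxy => by
    have h : A x ≤ ∫ ω, (max (V ω + βh * w) (-y) + (y - x)) ∂P := by
      refine integral_mono (hint _) ((hint _).add (integrable_const _)) fun ω => max_le ?_ ?_
      · linarith [le_max_left (V ω + βh * w) (-y)]
      · linarith [le_max_right (V ω + βh * w) (-y)]
    rw [integral_add (hint _) (integrable_const _)] at h
    simp only [integral_const, probReal_univ, one_smul] at h
    simp only [hAdef] at h ⊢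
    linarith
  have hA_cont : Continuous A := by
    refine (LipschitzWith.of_le_add fun x y => ?_).continuous
    rw [Real.dist_eq]
    rcases le_total x y with h | h
    · have : A x + x ≤ A y + y := hA_add h
      linarith [neg_abs_le (x - y)]
    · linarith [hA_anti h, abs_nonneg (x - y)]
  have hc : 0 ≤ w - βh * w := by linarith
  have hpos : Integrable (fun ω => max (V ω) 0) P := by
    simpa using integrable_max_of_integrable_pos_part hV hw hA2 0
  obtain ⟨n, hn⟩ := exists_integral_max_neg_add_neg hV hw hpos hA3
  have hAn : A (n - βh * w) = ∫ ω, max (V ω) (-n) ∂P + βh * w := by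
    have h : A (n - βh * w) = ∫ ω, (max (V ω) (-n) + βh * w) ∂P := by
      refine integral_congr_ae (ae_of_all _ fun ω => ?_)
      simp only
      rw [← max_add_add_right]
      congr 1
      ring
    rw [h, integral_add (by simpa using
      integrable_max_of_integrable_pos_part hV hw hA2 (-n)) (integrable_const _)]
    simp
  refine exists_last_zero (M := n - βh * w) (C := A (n - βh * w) + (w - βh * w)) ?_ ?_ ?_ ?_ ?_
  · intro x y hxy
    simp only [hueq]
    have h1 : A x + x ≤ A y + y := hA_add hxy
    have h2 := mul_le_mul_of_nonneg_left (F.mono hxy) hc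
    linarith
  · intro x
    rw [funext hueq]
    exact hA_cont.continuousWithinAt.add (continuousWithinAt_const.mul (F.right_continuous x))
  · simp only [uhat, zero_mul, sub_zero]
    refine setIntegral_nonneg (measurableSet_le measurable_const hV) fun ω hω => ?_
    have : V ω ≥ -0 - βh * w := hω
    linarith
  · linarith
  · intro z hz
    rw [hueq]
    have h1 : F z ≤ 1 := ProbabilityTheory.cdf_le_one _ z
    have h2 := hA_anti hz
    nlinarith
end

section
/- For any penalty z ≥ 0, the subjective expected utility is monotonically increasing in the subjective present-bias factor: if β̂ ≥ β̂' (with β̂, β̂' ∈ [0,1]), then û_{β̂}(z) ≥ û_{β̂'}(z), where û_{β̂} and û_{β̂'} denote the subjective expected utility computed with bias factors β̂ and β̂' respectively (with the same V and w). -/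
open MeasureTheory Real Set Filter
open scoped ENNReal

/-- If `max (f + c) 0` is integrable, then `f + c` is integrable on every superlevel set of `f`. -/
theorem integrableOn_add_const_superlevel {Ω : Type*} [MeasurableSpace Ω] {P : Measure Ω}
    [IsFiniteMeasure P] {f : Ω → ℝ} (hf : Measurable f) {c : ℝ}
    (hint : Integrable (fun ω => max (f ω + c) 0) P) (t : ℝ) :
    IntegrableOn (fun ω => f ω + c) {ω | f ω ≥ t} P := by
  refine Integrable.mono' (hint.add (integrable_const |t + c|)).integrableOn
    (hf.add_const c).aestronglyMeasurable ?_
  filter_upwards [ae_restrict_mem (measurableSet_le measurable_const hf)] with ω hω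
  have hω' : t ≤ f ω := hω
  rw [Pi.add_apply, Real.norm_eq_abs, abs_le]
  constructor
  · linarith [neg_abs_le (t + c), le_max_right (f ω + c) 0]
  · linarith [abs_nonneg (t + c), le_max_left (f ω + c) 0]

theorem integrable_indicator_sub_indicator {Ω : Type*} [MeasurableSpace Ω] {P : Measure Ω}
    [IsFiniteMeasure P] {V : Ω → ℝ} (hV : Measurable V) {w : ℝ}
    (hint : Integrable (fun ω => max (V ω + w) 0) P) (t z : ℝ) :
    Integrable (fun ω => {ω | V ω ≥ t}.indicator (fun ω => V ω + w) ω
      - {ω | V ω < t}.indicator (fun _ => z) ω) P :=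
  ((integrableOn_add_const_superlevel hV hint t).integrable_indicator
    (measurableSet_le measurable_const hV)).sub
    ((integrable_const z).indicator (measurableSet_lt hV measurable_const))

/-- The subjective expected utility as the expectation of a single payoff. -/
theorem uhat_eq_integral {Ω : Type*} [MeasurableSpace Ω] {P : Measure Ω}
    [IsFiniteMeasure P] {V : Ω → ℝ} (hV : Measurable V) {w : ℝ}
    (hint : Integrable (fun ω => max (V ω + w) 0) P) (βh z : ℝ) :
    uhat P V w βh z = ∫ ω, ({ω | V ω ≥ -z - βh * w}.indicator (fun ω => V ω + w) ω
      - {ω | V ω < -z - βh * w}.indicator (fun _ => z) ω) ∂P := by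
  have hge : MeasurableSet {ω | V ω ≥ -z - βh * w} := measurableSet_le measurable_const hV
  have hlt : MeasurableSet {ω | V ω < -z - βh * w} := measurableSet_lt hV measurable_const
  rw [integral_sub
      ((integrableOn_add_const_superlevel hV hint _).integrable_indicator hge)
      ((integrable_const z).indicator hlt),
    integral_indicator hge, integral_indicator_const z hlt, uhat, smul_eq_mul, mul_comm z,
    measureReal_def]

/-- For any penalty `z ≥ 0`, the subjective expected utility is monotonically increasing
in the subjective present-bias factor: if `β̂ ≥ β̂'` then `û_{β̂}(z) ≥ û_{β̂'}(z)`. -/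
theorem uhat_mono_in_bias {Ω : Type*} [MeasurableSpace Ω] (P : Measure Ω)
    [IsProbabilityMeasure P] (V : Ω → ℝ) (hV : Measurable V)
    (w : ℝ) (hw : 0 ≤ w)
    (βh βh' : ℝ) (hβh : βh ∈ Set.Icc (0 : ℝ) 1) (hβh' : βh' ∈ Set.Icc (0 : ℝ) 1)
    (hle : βh' ≤ βh)
    (hA2 : Integrable (fun ω => max (V ω + w) 0) P)
    (z : ℝ) (hz : 0 ≤ z) :
    uhat P V w βh' z ≤ uhat P V w βh z := by
  rw [uhat_eq_integral hV hA2, uhat_eq_integral hV hA2]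
  refine integral_mono (integrable_indicator_sub_indicator hV hA2 _ z)
    (integrable_indicator_sub_indicator hV hA2 _ z) fun ω => ?_
  have hthreshold : βh' * w ≤ βh * w := mul_le_mul_of_nonneg_right hle hw
  have hbias : βh * w ≤ w := mul_le_of_le_one_left hw hβh.2
  simp only [indicator_apply, mem_ofPred_eq]
  split_ifs <;> linarith
end

section
/- The dominant-strategy bid under the two-bid penalty-bidding mechanism is monotone in the subjective present-bias factor: if β̂ ≥ β̂' (with β̂, β̂' ∈ [0,1]), then the zero-crossings satisfy z⁰_{β̂} ≥ z⁰_{β̂'}, where z⁰_{β̂} is the zero-crossing of Û_{β̂}(z) = sup_{z' ≥ z} û_{β̂}(z') and similarly for β̂'. -/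
open MeasureTheory Real Set Filter
open scoped ENNReal

/-- A random variable whose positive part `(V + w)⁺` is integrable is integrable on the events
where `V` is bounded below. -/
lemma integrableOn_add_const_setOf_ge {Ω : Type*} [MeasurableSpace Ω] {P : Measure Ω}
    [IsFiniteMeasure P] {V : Ω → ℝ} (hV : Measurable V) {w : ℝ}
    (hint : Integrable (fun ω => max (V ω + w) 0) P) (c : ℝ) :
    IntegrableOn (fun ω => V ω + w) {ω | V ω ≥ c} P := by
  refine Integrable.mono' (g := fun ω => max (V ω + w) 0 + |c + w|)
    (hint.integrableOn.add (integrable_const _)) (hV.add_const w).aestronglyMeasurable ?_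
  refine (ae_restrict_iff' (measurableSet_le measurable_const hV)).2 (ae_of_all _ fun ω hω => ?_)
  have hc : c ≤ V ω := hω
  rw [Real.norm_eq_abs]
  have h1 := le_max_left (V ω + w) 0
  have h2 := le_max_right (V ω + w) 0
  have h3 := neg_abs_le (c + w)
  exact abs_le.2 ⟨by linarith, by linarith [abs_nonneg (c + w)]⟩

/-- The subjective expected utility as the expected gain over not showing up, minus the penalty. -/
lemma uhat_eq_setIntegral_sub {Ω : Type*} [MeasurableSpace Ω] {P : Measure Ω}
    [IsProbabilityMeasure P] {V : Ω → ℝ} (hV : Measurable V) {w : ℝ}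
    (hint : Integrable (fun ω => max (V ω + w) 0) P) (b z : ℝ) :
    uhat P V w b z = (∫ ω in {ω | V ω ≥ -z - b * w}, (V ω + w + z) ∂P) - z := by
  have hcompl : {ω | V ω < -z - b * w} = {ω | V ω ≥ -z - b * w}ᶜ := by
    ext ω
    exact (not_le (a := -z - b * w) (b := V ω)).symm
  have hmeas : MeasurableSet {ω | V ω ≥ -z - b * w} := measurableSet_le measurable_const hV
  have hprob := probReal_compl_eq_one_sub (μ := P) hmeas
  rw [uhat, integral_add (integrableOn_add_const_setOf_ge hV hint _) (integrable_const z),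
    setIntegral_const, hcompl, ← measureReal_def, hprob, smul_eq_mul]
  ring

/-- At every penalty, the subjective expected utility is monotone in the bias factor on
`(-∞, 1]`. -/
lemma uhat_mono_bias {Ω : Type*} [MeasurableSpace Ω] {P : Measure Ω}
    [IsProbabilityMeasure P] {V : Ω → ℝ} (hV : Measurable V) {w : ℝ} (hw : 0 ≤ w)
    (hint : Integrable (fun ω => max (V ω + w) 0) P) {b b' : ℝ} (hb : b ≤ 1) (hle : b' ≤ b)
    (z : ℝ) : uhat P V w b' z ≤ uhat P V w b z := by
  rw [uhat_eq_setIntegral_sub hV hint, uhat_eq_setIntegral_sub hV hint]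
  refine sub_le_sub_right (setIntegral_mono_set
    ((integrableOn_add_const_setOf_ge hV hint _).add (integrable_const z)) ?_ ?_) z
  · refine (ae_restrict_iff' (measurableSet_le measurable_const hV)).2
      (ae_of_all _ fun ω hω => ?_)
    have hω' : -z - b * w ≤ V ω := hω
    show 0 ≤ V ω + w + z
    linarith [mul_le_mul_of_nonneg_right hb hw]
  · refine ae_of_all _ fun ω hω => ?_
    have hω' : -z - b' * w ≤ V ω := hω
    show -z - b * w ≤ V ω
    linarith [mul_le_mul_of_nonneg_right hle hw]

/-- The dominant-strategy bid is monotone in the subjective present-bias factor: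
if `β̂ ≥ β̂'`, then the zero-crossings of `Û_{β̂}` and `Û_{β̂'}` satisfy `z⁰_{β̂} ≥ z⁰_{β̂'}`. -/
theorem zero_crossing_mono_in_bias {Ω : Type*} [MeasurableSpace Ω] (P : Measure Ω)
    [IsProbabilityMeasure P] (V : Ω → ℝ) (hV : Measurable V)
    (w : ℝ) (hw : 0 ≤ w)
    (βh βh' : ℝ) (hβh : βh ∈ Set.Icc (0 : ℝ) 1) (hβh' : βh' ∈ Set.Icc (0 : ℝ) 1)
    (hle : βh' ≤ βh)
    (hA2 : Integrable (fun ω => max (V ω + w) 0) P)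
    (hA3 : (((∫ ω, max (V ω) 0 ∂P : ℝ) : EReal)
        - ((∫⁻ ω, ENNReal.ofReal (-(V ω)) ∂P : ℝ≥0∞) : EReal)) + (w : ℝ) < 0)
    (z0 z0' : ℝ)
    (hz0 : sSup (uhat P V w βh '' Set.Ici z0) = 0)
    (hz0dec : ∀ z > z0, sSup (uhat P V w βh '' Set.Ici z) < 0)
    (hz0' : sSup (uhat P V w βh' '' Set.Ici z0') = 0)
    (hz0dec' : ∀ z > z0', sSup (uhat P V w βh' '' Set.Ici z) < 0) :
    z0' ≤ z0 := by
  by_contra! hlt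
  have hneg := hz0dec z0' hlt
  have hbdd : BddAbove (uhat P V w βh '' Set.Ici z0') := by
    by_contra hunb
    exact hneg.ne (Real.sSup_of_not_bddAbove hunb)
  have hsup : sSup (uhat P V w βh' '' Set.Ici z0') ≤ sSup (uhat P V w βh '' Set.Ici z0') := by
    refine csSup_le (Set.nonempty_Ici.image _) ?_
    rintro _ ⟨z, hz, rfl⟩
    exact (uhat_mono_bias hV hw hA2 hβh.2 hle z).trans
      (le_csSup hbdd (Set.mem_image_of_mem _ hz))
  linarith
end

section
/- Under the exponential type model, for every z ≥ -β̂·w, the subjective expected utility equals û(z) = w - 1/λ + e^{-λ(β̂·w + z)}·(1/λ - (1 - β̂)·w). -/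
open MeasureTheory Real Set Filter ProbabilityTheory
open scoped ENNReal

/-- Integration against the exponential distribution over `(-∞, t]`. -/
lemma setIntegral_Iic_expMeasure {r t : ℝ} (hr : 0 < r) (ht : 0 ≤ t) (g : ℝ → ℝ) :
    ∫ x in Iic t, g x ∂expMeasure r = ∫ x in 0..t, r * Real.exp (-(r * x)) * g x := by
  have hmeas : Measurable (exponentialPDF r) :=
    (measurable_exponentialPDFReal r).ennreal_ofReal
  have hdens : expMeasure r = volume.withDensity (exponentialPDF r) := rfl
  rw [hdens, setIntegral_withDensity_eq_setIntegral_toReal_smul hmeas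
      (ae_of_all _ fun _ => ENNReal.ofReal_lt_top) g measurableSet_Iic,
    intervalIntegral.integral_of_le ht, ← integral_Icc_eq_integral_Ioc,
    setIntegral_eq_of_subset_of_forall_sdiff_eq_zero measurableSet_Iic
      (Icc_subset_Iic_self : Icc 0 t ⊆ Iic t)]
  · refine setIntegral_congr_fun measurableSet_Icc fun x hx => ?_
    simp only [smul_eq_mul]
    rw [exponentialPDF_of_nonneg hx.1, ENNReal.toReal_ofReal (by positivity)]
  · rintro x ⟨hxt, hx⟩
    have hx0 : x < 0 := lt_of_not_ge fun h => hx ⟨h, hxt⟩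
    simp [exponentialPDF_of_neg hx0]

/-- The tail of the exponential distribution. -/
lemma expMeasure_real_Ioi {r t : ℝ} (hr : 0 < r) (ht : 0 ≤ t) :
    (expMeasure r).real (Ioi t) = Real.exp (-(r * t)) := by
  have := isProbabilityMeasure_expMeasure hr
  rw [← compl_Iic, probReal_compl_eq_one_sub measurableSet_Iic, ← cdf_eq_real,
    cdf_expMeasure_eq hr, if_pos ht, sub_sub_cancel]

lemma integral_exp_mul_sub {r : ℝ} (hr : r ≠ 0) (w t : ℝ) :
    ∫ x in 0..t, r * Real.exp (-(r * x)) * (w - x)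
      = (t - w + 1 / r) * Real.exp (-(r * t)) + w - 1 / r := by
  have hderiv (x : ℝ) : HasDerivAt (fun y => (y - w + 1 / r) * Real.exp (-(r * y)))
      (r * Real.exp (-(r * x)) * (w - x)) x := by
    convert! (((hasDerivAt_id x).sub_const w).add_const (1 / r)).mul
      (((hasDerivAt_id x).const_mul r).neg.exp) using 1
    simp only [id_eq, Pi.neg_apply]
    field_simp
    ring
  rw [intervalIntegral.integral_eq_sub_of_hasDerivAt (fun x _ => hderiv x)
    (Continuous.intervalIntegrable (by fun_prop) _ _)]
  simp only [mul_zero, neg_zero, Real.exp_zero]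
  ring

/-- Exponential type model: `V = -X` with `X ~ Exp(λ)`.  For every `z ≥ -β̂·w`,
`û(z) = w - 1/λ + e^{-λ(β̂·w + z)}·(1/λ - (1 - β̂)·w)`. -/
theorem uhat_exponential {Ω : Type*} [MeasurableSpace Ω] (P : Measure Ω)
    [IsProbabilityMeasure P] (V : Ω → ℝ) (hV : Measurable V)
    (lam : ℝ) (hlam : 0 < lam)
    (hVexp : Measure.map (fun ω => -V ω) P = expMeasure lam)
    (w : ℝ) (hw : 0 ≤ w) (βh : ℝ) (hβh : βh ∈ Set.Icc (0 : ℝ) 1)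
    (z : ℝ) (hz : -βh * w ≤ z) :
    uhat P V w βh z
      = w - 1 / lam + Real.exp (-lam * (βh * w + z)) * (1 / lam - (1 - βh) * w) := by
  have hX : Measurable fun ω => -V ω := hV.neg
  have ht : 0 ≤ βh * w + z := by linarith
  have hge : {ω | V ω ≥ -z - βh * w} = (fun ω => -V ω) ⁻¹' Iic (βh * w + z) := by
    ext ω
    simp only [mem_ofPred_eq, mem_preimage, mem_Iic]
    constructor <;> intro h <;> linarith
  have hlt : {ω | V ω < -z - βh * w} = (fun ω => -V ω) ⁻¹' Ioi (βh * w + z) := by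
    ext ω
    simp only [mem_ofPred_eq, mem_preimage, mem_Ioi]
    constructor <;> intro h <;> linarith
  have hint : ∫ ω in {ω | V ω ≥ -z - βh * w}, (V ω + w) ∂P
      = ∫ x in Iic (βh * w + z), (w - x) ∂expMeasure lam := by
    rw [← hVexp, setIntegral_map measurableSet_Iic (Measurable.aestronglyMeasurable (by fun_prop)) hX.aemeasurable, hge]
    simp only [sub_neg_eq_add, add_comm]
  have hprob : (P {ω | V ω < -z - βh * w}).toReal = Real.exp (-(lam * (βh * w + z))) := by
    rw [← expMeasure_real_Ioi hlam ht, ← hVexp, measureReal_def,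
      Measure.map_apply hX measurableSet_Ioi, hlt]
  rw [uhat, hint, hprob, setIntegral_Iic_expMeasure hlam ht, integral_exp_mul_sub hlam.ne',
    neg_mul]
  ring
end

section
/- Under the exponential type model with 0 < w and λ·w < 1, the number z⁰ = -β̂·w + (1/λ)·log((1 - λ·w·(1 - β̂))/(1 - λ·w)) satisfies z⁰ ≥ 0, û(z⁰) = 0, and û(z) < 0 for every z > z⁰; i.e., z⁰ is the maximum acceptable no-show penalty (the agent's dominant-strategy first-round bid). -/
open MeasureTheory Real Set Filter ProbabilityTheory
open scoped ENNReal

theorem setIntegral_Iic_sub_expMeasure {lam : ℝ} (hlam : 0 < lam) (w : ℝ) {a : ℝ} (ha : 0 ≤ a) :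
    ∫ x in Set.Iic a, (w - x) ∂(expMeasure lam)
      = (a + 1 / lam - w) * Real.exp (-lam * a) - (1 / lam - w) := by
  have hdens : expMeasure lam = volume.withDensity (exponentialPDF lam) := rfl
  have hmeas : Measurable (exponentialPDF lam) :=
    (measurable_exponentialPDFReal lam).ennreal_ofReal
  rw [hdens, setIntegral_withDensity_eq_setIntegral_toReal_smul hmeas
    (ae_of_all _ fun x => ENNReal.ofReal_lt_top) _ measurableSet_Iic,
    setIntegral_eq_of_subset_of_forall_sdiff_eq_zero measurableSet_Iic
      (Set.Icc_subset_Iic_self (a := 0) (b := a))]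
  · have hpdf : ∀ x ∈ Set.Icc 0 a, (exponentialPDF lam x).toReal • (w - x)
        = lam * (w - x) * Real.exp (-lam * x) := by
      intro x hx
      rw [exponentialPDF_of_nonneg hx.1, ENNReal.toReal_ofReal (by positivity), smul_eq_mul,
        neg_mul]
      ring
    rw [setIntegral_congr_fun measurableSet_Icc hpdf, integral_Icc_eq_integral_Ioc,
      ← intervalIntegral.integral_of_le ha]
    have hderiv : ∀ x ∈ Set.uIcc 0 a,
        HasDerivAt (fun x => (x + 1 / lam - w) * Real.exp (-lam * x))
          (lam * (w - x) * Real.exp (-lam * x)) x := by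
      intro x _
      have h1 : HasDerivAt (fun x : ℝ => x + 1 / lam - w) 1 x :=
        ((hasDerivAt_id x).add_const _).sub_const _
      have h2 : HasDerivAt (fun x : ℝ => Real.exp (-lam * x))
          (Real.exp (-lam * x) * (-lam * 1)) x :=
        ((hasDerivAt_id x).const_mul (-lam)).exp
      refine (h1.mul h2).congr_deriv ?_
      field_simp
      ring
    rw [intervalIntegral.integral_eq_sub_of_hasDerivAt hderiv
      ((by fun_prop : Continuous fun x => lam * (w - x) * Real.exp (-lam * x)).intervalIntegrable
        _ _)]
    simp
  · rintro x ⟨hxa, hx⟩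
    have hx0 : x < 0 := by
      by_contra! h
      exact hx ⟨h, hxa⟩
    simp [exponentialPDF_of_neg hx0]

theorem expMeasure_real_Ioi_s14 {lam : ℝ} (hlam : 0 < lam) {a : ℝ} (ha : 0 ≤ a) :
    (expMeasure lam).real (Set.Ioi a) = Real.exp (-lam * a) := by
  have := isProbabilityMeasure_expMeasure hlam
  have h := cdf_expMeasure_eq hlam a
  rw [cdf_eq_real, if_pos ha] at h
  rw [← Set.compl_Iic, probReal_compl_eq_one_sub measurableSet_Iic, h, neg_mul]
  ring

theorem uhat_eq_of_map_neg_eq_expMeasure {Ω : Type*} [MeasurableSpace Ω] {P : Measure Ω}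
    {V : Ω → ℝ} (hV : Measurable V) {lam : ℝ} (hlam : 0 < lam)
    (hVexp : Measure.map (fun ω => -V ω) P = expMeasure lam) (w βh : ℝ) {z : ℝ}
    (hz : 0 ≤ z + βh * w) :
    uhat P V w βh z
      = (w - 1 / lam) + (1 / lam - w * (1 - βh)) * Real.exp (-lam * (z + βh * w)) := by
  have hmap : Measurable fun ω => -V ω := hV.neg
  have hle : {ω | V ω ≥ -z - βh * w} = (fun ω => -V ω) ⁻¹' Set.Iic (z + βh * w) := by
    ext ω
    simp only [Set.mem_ofPred_eq, Set.mem_preimage, Set.mem_Iic]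
    constructor <;> intro h <;> linarith
  have hlt : {ω | V ω < -z - βh * w} = (fun ω => -V ω) ⁻¹' Set.Ioi (z + βh * w) := by
    ext ω
    simp only [Set.mem_ofPred_eq, Set.mem_preimage, Set.mem_Ioi]
    constructor <;> intro h <;> linarith
  have hint : ∫ ω in {ω | V ω ≥ -z - βh * w}, (V ω + w) ∂P
      = ∫ x in Set.Iic (z + βh * w), (w - x) ∂(expMeasure lam) := by
    rw [← hVexp, setIntegral_map measurableSet_Iic
      (by fun_prop : Continuous fun x : ℝ => w - x).aestronglyMeasurable hmap.aemeasurable, hle]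
    simp only [sub_neg_eq_add, add_comm w]
  have hprob : (P {ω | V ω < -z - βh * w}).toReal
      = (expMeasure lam).real (Set.Ioi (z + βh * w)) := by
    rw [hlt, ← Measure.map_apply hmap measurableSet_Ioi, hVexp, measureReal_def]
  rw [uhat, hint, hprob, setIntegral_Iic_sub_expMeasure hlam w hz, expMeasure_real_Ioi_s14 hlam hz]
  ring

theorem le_log_add_div {u t : ℝ} (hu : 0 < u) (ht : 0 ≤ t) (hut : u + t ≤ 1) :
    t ≤ Real.log ((u + t) / u) := by
  have hpos : 0 < u + t := by linarith
  have h := Real.one_sub_inv_le_log_of_pos (div_pos hpos hu)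
  refine le_trans ?_ h
  rw [inv_div, one_sub_div hpos.ne', le_div_iff₀ hpos]
  nlinarith

/-- Exponential type model with `0 < w` and `λ·w < 1`: the number
`z⁰ = -β̂·w + (1/λ)·log((1 - λ·w·(1 - β̂))/(1 - λ·w))` satisfies `z⁰ ≥ 0`, `û(z⁰) = 0` and
`û(z) < 0` for every `z > z⁰`; it is the agent's maximum acceptable no-show penalty. -/
theorem uhat_exponential_zero_crossing {Ω : Type*} [MeasurableSpace Ω] (P : Measure Ω)
    [IsProbabilityMeasure P] (V : Ω → ℝ) (hV : Measurable V)
    (lam : ℝ) (hlam : 0 < lam)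
    (hVexp : Measure.map (fun ω => -V ω) P = expMeasure lam)
    (w : ℝ) (hw : 0 < w) (hlw : lam * w < 1)
    (βh : ℝ) (hβh : βh ∈ Set.Icc (0 : ℝ) 1) :
    0 ≤ -βh * w + (1 / lam) * Real.log ((1 - lam * w * (1 - βh)) / (1 - lam * w))
      ∧ uhat P V w βh
          (-βh * w + (1 / lam) * Real.log ((1 - lam * w * (1 - βh)) / (1 - lam * w))) = 0
      ∧ ∀ z > -βh * w + (1 / lam) * Real.log ((1 - lam * w * (1 - βh)) / (1 - lam * w)),
          uhat P V w βh z < 0 := by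
  obtain ⟨hβ0, hβ1⟩ := hβh
  have hu : 0 < 1 - lam * w := by linarith
  have hlw0 : 0 < lam * w := mul_pos hlam hw
  have hnum : 0 < 1 - lam * w * (1 - βh) := by nlinarith
  set L := Real.log ((1 - lam * w * (1 - βh)) / (1 - lam * w)) with hL
  have hlog : lam * w * βh ≤ L := by
    have h := le_log_add_div hu (mul_nonneg hlw0.le hβ0) (by nlinarith)
    rwa [show 1 - lam * w + lam * w * βh = 1 - lam * w * (1 - βh) by ring] at h
  have hz0 : 0 ≤ -βh * w + 1 / lam * L := by
    have h : -βh * w + 1 / lam * L = (L - lam * w * βh) / lam := by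
      field_simp
      ring
    rw [h]
    exact div_nonneg (by linarith) hlam.le
  have hβw : 0 ≤ βh * w := mul_nonneg hβ0 hw.le
  have hzero : (w - 1 / lam) + (1 / lam - w * (1 - βh)) * Real.exp (-L) = 0 := by
    rw [Real.exp_neg, hL, Real.exp_log (div_pos hnum hu), inv_div,
      show 1 / lam - w * (1 - βh) = (1 - lam * w * (1 - βh)) / lam by field_simp,
      div_mul_div_comm, mul_comm lam (1 - lam * w * (1 - βh)), mul_div_mul_left _ _ hnum.ne']
    field_simp
    ring
  refine ⟨hz0, ?_, fun z hz => ?_⟩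
  · rw [uhat_eq_of_map_neg_eq_expMeasure hV hlam hVexp w βh (by linarith),
      show -lam * (-βh * w + 1 / lam * L + βh * w) = -L by field_simp; ring]
    exact hzero
  · rw [uhat_eq_of_map_neg_eq_expMeasure hV hlam hVexp w βh (by linarith), ← hzero]
    have hcoef : 0 < 1 / lam - w * (1 - βh) := by
      have h : 1 / lam - w * (1 - βh) = (1 - lam * w * (1 - βh)) / lam := by field_simp
      rw [h]
      exact div_pos hnum hlam
    have hexp : -lam * (z + βh * w) < -L := by
      have h : lam * (1 / lam * L) = L := by field_simp
      nlinarith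
    gcongr
end

section
/- Under the uniform type model, for every z with -β̂·w ≤ z ≤ α - β̂·w, the subjective expected utility equals û(z) = (1/(2α))·(z² - 2(α - w)·z + β̂·(2 - β̂)·w²). -/
open MeasureTheory Real Set Filter
open scoped ENNReal

/-- `V` is uniformly distributed on `[-α, 0]`: the law of `V` is Lebesgue measure
restricted to `[-α, 0]`, normalized by `1/α`. -/
def IsUniformNegIcc {Ω : Type*} [MeasurableSpace Ω] (P : Measure Ω)
    (V : Ω → ℝ) (α : ℝ) : Prop :=
  Measure.map V P = ENNReal.ofReal (1 / α) • volume.restrict (Set.Icc (-α) 0)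

/-- The expectation of `V + w` on the event `V ≥ t` for `V` uniform on `[-α, 0]`. -/
theorem setIntegral_ge_of_isUniformNegIcc {Ω : Type*} [MeasurableSpace Ω] {P : Measure Ω}
    {V : Ω → ℝ} (hV : Measurable V) {α : ℝ} (hα : 0 < α) (hVuni : IsUniformNegIcc P V α)
    (w : ℝ) {t : ℝ} (ht : t ∈ Set.Icc (-α) 0) :
    ∫ ω in {ω | V ω ≥ t}, (V ω + w) ∂P = (1 / α) * (-t ^ 2 / 2 - w * t) := by
  have hmap : ∫ ω in {ω | V ω ≥ t}, (V ω + w) ∂P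
      = ∫ v in Set.Ici t, (v + w) ∂(Measure.map V P) :=
    (setIntegral_map (f := fun v => v + w) measurableSet_Ici
      (measurable_id.add_const w).aestronglyMeasurable hV.aemeasurable).symm
  have hset : Set.Ici t ∩ Set.Icc (-α) 0 = Set.Icc t 0 := by
    ext v
    simp only [Set.mem_inter_iff, Set.mem_Ici, Set.mem_Icc]
    exact ⟨fun h => ⟨h.1, h.2.2⟩, fun h => ⟨h.1, ht.1.trans h.1, h.2⟩⟩
  rw [hmap, hVuni, Measure.restrict_smul, Measure.restrict_restrict measurableSet_Ici, hset,
    integral_smul_measure, ENNReal.toReal_ofReal (by positivity), smul_eq_mul,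
    integral_Icc_eq_integral_Ioc, ← intervalIntegral.integral_of_le ht.2,
    intervalIntegral.integral_add (by simp) (by simp), integral_id,
    intervalIntegral.integral_const, smul_eq_mul]
  ring

/-- The cumulative distribution function of `V` uniform on `[-α, 0]`. -/
theorem measure_lt_of_isUniformNegIcc {Ω : Type*} [MeasurableSpace Ω] {P : Measure Ω}
    {V : Ω → ℝ} (hV : Measurable V) {α : ℝ} (hα : 0 < α) (hVuni : IsUniformNegIcc P V α)
    {t : ℝ} (ht : t ∈ Set.Icc (-α) 0) :
    (P {ω | V ω < t}).toReal = (1 / α) * (t + α) := by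
  have hmap : P {ω | V ω < t} = Measure.map V P (Set.Iio t) :=
    (Measure.map_apply hV measurableSet_Iio).symm
  have hset : Set.Iio t ∩ Set.Icc (-α) 0 = Set.Ico (-α) t := by
    ext v
    simp only [Set.mem_inter_iff, Set.mem_Iio, Set.mem_Icc, Set.mem_Ico]
    exact ⟨fun h => ⟨h.2.1, h.1⟩, fun h => ⟨h.2, h.1, h.2.le.trans ht.2⟩⟩
  rw [hmap, hVuni, Measure.smul_apply, Measure.restrict_apply measurableSet_Iio, hset,
    Real.volume_Ico, smul_eq_mul, ENNReal.toReal_mul, ENNReal.toReal_ofReal (by positivity),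
    ENNReal.toReal_ofReal (by linarith [ht.1]), sub_neg_eq_add]

/-- Uniform type model: for every `z` with `-β̂·w ≤ z ≤ α - β̂·w`,
`û(z) = (1/(2α))·(z² - 2(α - w)·z + β̂·(2 - β̂)·w²)`. -/
theorem uhat_uniform {Ω : Type*} [MeasurableSpace Ω] (P : Measure Ω)
    [IsProbabilityMeasure P] (V : Ω → ℝ) (hV : Measurable V)
    (α : ℝ) (hα : 0 < α) (hVuni : IsUniformNegIcc P V α)
    (w : ℝ) (hw : 0 ≤ w) (βh : ℝ) (hβh : βh ∈ Set.Icc (0 : ℝ) 1)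
    (z : ℝ) (hz1 : -βh * w ≤ z) (hz2 : z ≤ α - βh * w) :
    uhat P V w βh z
      = (1 / (2 * α)) * (z ^ 2 - 2 * (α - w) * z + βh * (2 - βh) * w ^ 2) := by
  have ht : -z - βh * w ∈ Set.Icc (-α) 0 := ⟨by linarith, by linarith⟩
  rw [uhat, setIntegral_ge_of_isUniformNegIcc hV hα hVuni w ht,
    measure_lt_of_isUniformNegIcc hV hα hVuni ht]
  field_simp
  ring
end

section
/- Under the uniform type model with 0 < w < α/2, the number z⁰ = α - w - √(α² - 2α·w + (1 - β̂)²·w²) is well defined (the expression under the square root is positive), satisfies 0 ≤ z⁰ ≤ α - w, û(z⁰) = 0, and û(z) < 0 for every z with z⁰ < z ≤ α - β̂·w; i.e., z⁰ is the maximum acceptable no-show penalty (the agent's dominant-strategy first-round bid). -/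
open MeasureTheory Real Set Filter
open scoped ENNReal

theorem uhat_eq_of_isUniformNegIcc {Ω : Type*} [MeasurableSpace Ω] {P : Measure Ω}
    {V : Ω → ℝ} (hV : Measurable V) {α : ℝ} (hα : 0 < α) (hVuni : IsUniformNegIcc P V α)
    {w βh z : ℝ} (h0 : 0 ≤ z + βh * w) (h1 : z + βh * w ≤ α) :
    uhat P V w βh z =
      (z ^ 2 / 2 - (α - w) * z + βh * w * w - (βh * w) ^ 2 / 2) / α := by
  set c : ℝ := -z - βh * w with hc
  have hint : ∫ ω in {ω | V ω ≥ c}, (V ω + w) ∂P = (-(c ^ 2) / 2 - w * c) / α := by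
    have hmap : ∫ ω in {ω | V ω ≥ c}, (V ω + w) ∂P
        = ∫ v in Set.Ici c, (v + w) ∂(Measure.map V P) :=
      (setIntegral_map (f := fun v : ℝ => v + w) measurableSet_Ici
        (by fun_prop) hV.aemeasurable).symm
    have hset : Set.Ici c ∩ Set.Icc (-α) 0 = Set.Icc c 0 := by
      ext v
      simp only [Set.mem_inter_iff, Set.mem_Ici, Set.mem_Icc]
      constructor
      · rintro ⟨h, -, h'⟩
        exact ⟨h, h'⟩
      · rintro ⟨h, h'⟩
        exact ⟨h, by linarith, h'⟩
    rw [hmap, hVuni, Measure.restrict_smul, integral_smul_measure,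
      Measure.restrict_restrict measurableSet_Ici, hset, integral_Icc_eq_integral_Ioc,
      ← intervalIntegral.integral_of_le (by linarith : c ≤ 0),
      intervalIntegral.integral_add (by simp) (by simp), integral_id,
      intervalIntegral.integral_const, ENNReal.toReal_ofReal (by positivity)]
    simp only [smul_eq_mul]
    ring
  have hprob : (P {ω | V ω < c}).toReal = (c + α) / α := by
    have hmap : P {ω | V ω < c} = Measure.map V P (Set.Iio c) :=
      (Measure.map_apply hV measurableSet_Iio).symm
    have hset : Set.Iio c ∩ Set.Icc (-α) 0 = Set.Ico (-α) c := by
      ext v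
      simp only [Set.mem_inter_iff, Set.mem_Iio, Set.mem_Icc, Set.mem_Ico]
      constructor
      · rintro ⟨h, h', -⟩
        exact ⟨h', h⟩
      · rintro ⟨h, h'⟩
        exact ⟨h', h, by linarith⟩
    rw [hmap, hVuni, Measure.smul_apply, Measure.restrict_apply measurableSet_Iio, hset,
      Real.volume_Ico, smul_eq_mul, ENNReal.toReal_mul, ENNReal.toReal_ofReal (by positivity),
      ENNReal.toReal_ofReal (by linarith)]
    ring
  rw [uhat, hint, hprob, hc]
  field_simp
  ring

/-- Uniform type model with `0 < w < α/2`: the number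
`z⁰ = α - w - √(α² - 2α·w + (1 - β̂)²·w²)` is well defined (the expression under the square
root is positive), satisfies `0 ≤ z⁰ ≤ α - w`, `û(z⁰) = 0`, and `û(z) < 0` for every `z`
with `z⁰ < z ≤ α - β̂·w`; it is the agent's maximum acceptable no-show penalty. -/
theorem uhat_uniform_zero_crossing {Ω : Type*} [MeasurableSpace Ω] (P : Measure Ω)
    [IsProbabilityMeasure P] (V : Ω → ℝ) (hV : Measurable V)
    (α : ℝ) (hα : 0 < α) (hVuni : IsUniformNegIcc P V α)
    (w : ℝ) (hw : 0 < w) (hwα : w < α / 2)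
    (βh : ℝ) (hβh : βh ∈ Set.Icc (0 : ℝ) 1) :
    0 < α ^ 2 - 2 * α * w + (1 - βh) ^ 2 * w ^ 2
      ∧ 0 ≤ α - w - Real.sqrt (α ^ 2 - 2 * α * w + (1 - βh) ^ 2 * w ^ 2)
      ∧ α - w - Real.sqrt (α ^ 2 - 2 * α * w + (1 - βh) ^ 2 * w ^ 2) ≤ α - w
      ∧ uhat P V w βh (α - w - Real.sqrt (α ^ 2 - 2 * α * w + (1 - βh) ^ 2 * w ^ 2)) = 0
      ∧ ∀ z : ℝ, α - w - Real.sqrt (α ^ 2 - 2 * α * w + (1 - βh) ^ 2 * w ^ 2) < z →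
          z ≤ α - βh * w → uhat P V w βh z < 0 := by
  obtain ⟨hβ0, hβ1⟩ := hβh
  have hb0 : 0 ≤ βh * w := by positivity
  have hbw : βh * w ≤ w := mul_le_of_le_one_left hw.le hβ1
  have hgap : 0 < α ^ 2 - 2 * α * w := by nlinarith
  have hD : 0 < α ^ 2 - 2 * α * w + (1 - βh) ^ 2 * w ^ 2 := by positivity
  set s := Real.sqrt (α ^ 2 - 2 * α * w + (1 - βh) ^ 2 * w ^ 2) with hs
  have hs0 : 0 ≤ s := Real.sqrt_nonneg _
  have hsq : s ^ 2 = α ^ 2 - 2 * α * w + (1 - βh) ^ 2 * w ^ 2 := Real.sq_sqrt hD.le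
  have hs_le : s ≤ α - w := abs_le_of_sq_le_sq' (by nlinarith) (by linarith) |>.2
  have hs_gt : w - βh * w < s := lt_of_pow_lt_pow_left₀ 2 hs0 (by nlinarith)
  refine ⟨hD, by linarith, by linarith, ?_, fun z hz hzα => ?_⟩
  · rw [uhat_eq_of_isUniformNegIcc hV hα hVuni (by linarith) (by linarith), div_eq_zero_iff]
    left
    linear_combination hsq / 2
  · rw [uhat_eq_of_isUniformNegIcc hV hα hVuni (by linarith) (by linarith)]
    refine div_neg_of_neg_of_pos ?_ hα
    have hroots : 0 < (z - (α - w - s)) * (α - w + s - z) :=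
      mul_pos (by linarith) (by linarith)
    nlinarith
end
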